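/- arXiv:1007.4372 — 2 statements merged into one kernel-verified Lean document; each statement's English description precedes it below -/
import Mathlib

section
/- In the single-step multinomial game (N = 1), for any payoff function f : X → ℝ, the upper hedging price Ē_1(f) equals the maximum over all risk-neutral measures p on X of the expectation Σ_{a∈X} f(a)·p(a). -/
noncomputable def capitalAux (P : List ℝ → ℝ) : List ℝ → List ℝ → ℝ
  | _, [] => 0
  | pre, x :: rest => P pre * x + capitalAux P (pre ++ [x]) rest

/-- Upper hedging price of payoff `F` in the `N`-round multinomial game with move space `X`. -/
noncomputable def upperPrice (X : Finset ℝ) (N : ℕ) (F : List ℝ → ℝ) : ℝ :=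
  sInf {α : ℝ | ∃ P : List ℝ → ℝ,
    ∀ ξ : List ℝ, ξ.length = N → (∀ x ∈ ξ, x ∈ X) → F ξ ≤ α + capitalAux P [] ξ}

/-- Lower hedging price. -/
noncomputable def lowerPrice (X : Finset ℝ) (N : ℕ) (F : List ℝ → ℝ) : ℝ :=
  -upperPrice X N (fun ξ => -F ξ)

/-- A superhedge costs at least the expected payoff under any risk-neutral measure. -/
theorem expectation_le_of_superhedge {X : Finset ℝ} {f p : ℝ → ℝ} {α c : ℝ}
    (hp : ∀ a ∈ X, 0 ≤ p a) (hp1 : ∑ a ∈ X, p a = 1) (hp0 : ∑ a ∈ X, a * p a = 0)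
    (h : ∀ a ∈ X, f a ≤ α + c * a) : ∑ a ∈ X, f a * p a ≤ α :=
  calc
    ∑ a ∈ X, f a * p a ≤ ∑ a ∈ X, (α * p a + c * (a * p a)) :=
      Finset.sum_le_sum fun a ha => by nlinarith [mul_le_mul_of_nonneg_right (h a ha) (hp a ha)]
    _ = α := by
      rw [Finset.sum_add_distrib, ← Finset.mul_sum, ← Finset.mul_sum, hp1, hp0]
      ring

/-- The risk-neutral measure supported on two points `u ≤ 0 < v`. -/
theorem exists_riskNeutral_pair {X : Finset ℝ} {u v : ℝ} (hu : u ∈ X) (hv : v ∈ X)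
    (hu0 : u ≤ 0) (hv0 : 0 < v) (f : ℝ → ℝ) :
    ∃ p : ℝ → ℝ, (∀ a ∈ X, 0 ≤ p a) ∧ (∑ a ∈ X, p a) = 1 ∧
      (∑ a ∈ X, a * p a) = 0 ∧ (f u * v - f v * u) / (v - u) = ∑ a ∈ X, f a * p a := by
  have hd : 0 < v - u := by linarith
  have key (g : ℝ → ℝ) :
      ∑ a ∈ X, g a * ((if a = u then v / (v - u) else 0) + if a = v then -u / (v - u) else 0) =
        (g u * v - g v * u) / (v - u) := by
    simp only [mul_add, mul_ite, mul_zero, Finset.sum_add_distrib, Finset.sum_ite_eq', hu, hv,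
      if_true]
    ring
  refine ⟨fun a => (if a = u then v / (v - u) else 0) + if a = v then -u / (v - u) else 0,
    fun a _ => ?_, ?_, ?_, (key f).symm⟩
  · have h₁ : 0 ≤ v / (v - u) := by positivity
    have h₂ : 0 ≤ -u / (v - u) := div_nonneg (by linarith) hd.le
    dsimp only
    split_ifs <;> linarith
  · have h := key fun _ => 1
    simp only [one_mul] at h
    rw [h, div_self hd.ne']
  · rw [key fun a => a]
    ring

/-- A constant dominating every two-point price superhedges the payoff. -/
theorem exists_superhedge {X : Finset ℝ} (hpos : ∃ a ∈ X, 0 < a) {f : ℝ → ℝ} {α : ℝ}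
    (h : ∀ u ∈ X, ∀ v ∈ X, u ≤ 0 → 0 < v → (f u * v - f v * u) / (v - u) ≤ α) :
    ∃ c : ℝ, ∀ a ∈ X, f a ≤ α + c * a := by
  obtain ⟨b, hb, hb0⟩ := hpos
  obtain ⟨v, hv, hmax⟩ := (X.filter (0 < ·)).exists_max_image (fun a => (f a - α) / a)
    ⟨b, Finset.mem_filter.2 ⟨hb, hb0⟩⟩
  obtain ⟨hvX, hv0⟩ := Finset.mem_filter.1 hv
  refine ⟨(f v - α) / v, fun a ha => ?_⟩
  rcases lt_or_ge 0 a with ha0 | ha0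
  · have := (div_le_iff₀ ha0).1 (hmax a (Finset.mem_filter.2 ⟨ha, ha0⟩))
    linarith
  · have hav := (div_le_iff₀ (by linarith)).1 (h a ha v hvX ha0 hv0)
    have : f a - α ≤ (f v - α) * a / v := (le_div_iff₀ hv0).2 (by linarith)
    rw [div_mul_eq_mul_div]
    linarith

/-- A one-round strategy is a single real stake. -/
theorem upperPrice_one (X : Finset ℝ) (f : ℝ → ℝ) :
    upperPrice X 1 (fun ξ => f ξ.headI) = sInf {α : ℝ | ∃ c : ℝ, ∀ a ∈ X, f a ≤ α + c * a} := by
  unfold upperPrice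
  congr 1
  ext α
  constructor
  · rintro ⟨P, hP⟩
    refine ⟨P [], fun a ha => ?_⟩
    simpa [capitalAux] using hP [a] rfl (by simpa using ha)
  · rintro ⟨c, hc⟩
    refine ⟨fun _ => c, fun ξ hξ hX => ?_⟩
    obtain ⟨a, rfl⟩ := List.length_eq_one_iff.1 hξ
    simpa [capitalAux] using hc a (hX a (by simp))

/-- Single-step duality: the upper hedging price equals the maximum expectation of `f`
over all risk-neutral measures on `X`. -/
theorem single_step_duality (X : Finset ℝ)
    (hneg : ∃ a ∈ X, a < 0) (hpos : ∃ a ∈ X, 0 < a) (f : ℝ → ℝ) :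
    IsGreatest
      {v : ℝ | ∃ p : ℝ → ℝ, (∀ a ∈ X, 0 ≤ p a) ∧ (∑ a ∈ X, p a) = 1 ∧
        (∑ a ∈ X, a * p a) = 0 ∧ v = ∑ a ∈ X, f a * p a}
      (upperPrice X 1 (fun ξ => f ξ.headI)) := by
  obtain ⟨a, ha, ha0⟩ := hneg
  obtain ⟨b, hb, hb0⟩ := hpos
  obtain ⟨⟨u, v⟩, huv, hmax⟩ := (X.filter (· ≤ 0) ×ˢ X.filter (0 < ·)).exists_max_image
    (fun w => (f w.1 * w.2 - f w.2 * w.1) / (w.2 - w.1))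
    ⟨(a, b), by simp [ha, hb, ha0.le, hb0]⟩
  simp only [Finset.mem_product, Finset.mem_filter] at huv hmax
  obtain ⟨⟨huX, hu0⟩, hvX, hv0⟩ := huv
  obtain ⟨p, hp, hp1, hp0, hpf⟩ := exists_riskNeutral_pair huX hvX hu0 hv0 f
  obtain ⟨c, hc⟩ := exists_superhedge ⟨b, hb, hb0⟩ fun s hs t ht hs0 ht0 =>
    hmax (s, t) ⟨⟨hs, hs0⟩, ht, ht0⟩
  have hleast : IsLeast {α : ℝ | ∃ c : ℝ, ∀ a ∈ X, f a ≤ α + c * a}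
      ((f u * v - f v * u) / (v - u)) :=
    ⟨⟨c, hc⟩, fun α ⟨_, h⟩ => hpf.trans_le (expectation_le_of_superhedge hp hp1 hp0 h)⟩
  rw [upperPrice_one, hleast.csInf_eq]
  refine ⟨⟨p, hp, hp1, hp0, hpf⟩, ?_⟩
  rintro _ ⟨q, hq, hq1, hq0, rfl⟩
  exact expectation_le_of_superhedge hq hq1 hq0 hc
end

section
/- Let f : ℝ^N → ℝ be convex and suppose the smallest nonnegative element a_1⁺ of X is strictly positive; let a_1⁻ be the largest negative element of X. Then the lower hedging price of the restriction of f to X^N in the N-round game equals the binomial price E_{a_1⁻,a_1⁺}(f), i.e. the expectation of f under the i.i.d. product measure on {a_1⁻, a_1⁺}^N in which each coordinate equals a_1⁻ with probability a_1⁺/(a_1⁺ − a_1⁻) and equals a_1⁺ with probability −a_1⁻/(a_1⁺ − a_1⁻). -/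
/-- The binomial price of a European-type payoff `f : ℝ^N → ℝ` for the binomial model
`{an, ap}` with `an < 0 < ap`: the expectation of `f` under the i.i.d. product measure in
which each coordinate equals `an` with probability `ap / (ap - an)` and equals `ap` with
probability `-an / (ap - an)`. -/
noncomputable def binPrice (N : ℕ) (an ap : ℝ) (f : (Fin N → ℝ) → ℝ) : ℝ :=
  ∑ ε : Fin N → Bool,
    (∏ i, (if ε i then -an else ap) / (ap - an)) * f (fun i => if ε i then ap else an)

theorem capitalAux_cons_prefix (P : List ℝ → ℝ) (x : ℝ) (pre ξ : List ℝ) :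
    capitalAux P (x :: pre) ξ = capitalAux (fun l => P (x :: l)) pre ξ := by
  induction ξ generalizing pre with
  | nil => simp [capitalAux]
  | cons y ξ ih => simp [capitalAux, ih]

theorem binPrice_zero (an ap : ℝ) (f : (Fin 0 → ℝ) → ℝ) (x : Fin 0 → ℝ) :
    binPrice 0 an ap f = f x := by
  simp [binPrice, Subsingleton.elim _ x]

theorem binPrice_succ (n : ℕ) (an ap : ℝ) (f : (Fin (n + 1) → ℝ) → ℝ) :
    binPrice (n + 1) an ap f =
      ap / (ap - an) * binPrice n an ap (fun y => f (Fin.cons an y)) +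
        -an / (ap - an) * binPrice n an ap (fun y => f (Fin.cons ap y)) := by
  have path (b : Bool) (ε : Fin n → Bool) :
      f (fun i => if (Fin.consEquiv fun _ => Bool) (b, ε) i then ap else an) =
        f (Fin.cons (if b then ap else an) fun i => if ε i then ap else an) := by
    congr 1
    ext i
    refine Fin.cases ?_ (fun j => ?_) i <;> simp [Fin.consEquiv]
  have weight (b : Bool) (ε : Fin n → Bool) :
      ∏ i, (if (Fin.consEquiv fun _ => Bool) (b, ε) i then -an else ap) / (ap - an) =
        (if b then -an else ap) / (ap - an) *
          ∏ i, (if ε i then -an else ap) / (ap - an) := by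
    rw [Fin.prod_univ_succ]
    simp only [Fin.consEquiv, Equiv.coe_fn_mk, Fin.cons_zero, Fin.cons_succ]
  unfold binPrice
  rw [← (Fin.consEquiv fun _ => Bool).sum_comp, Fintype.sum_prod_type, Fintype.sum_bool,
    add_comm, Finset.mul_sum, Finset.mul_sum]
  simp only [path, weight, mul_assoc, if_true, Bool.false_eq_true, if_false]

theorem binPrice_neg (n : ℕ) (an ap : ℝ) (f : (Fin n → ℝ) → ℝ) :
    binPrice n an ap (fun y => -f y) = -binPrice n an ap f := by
  simp [binPrice]

theorem ConvexOn.fin_cons_right {n : ℕ} {f : (Fin (n + 1) → ℝ) → ℝ}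
    (hf : ConvexOn ℝ Set.univ f) (x : ℝ) :
    ConvexOn ℝ Set.univ fun y : Fin n → ℝ => f (Fin.cons x y) := by
  refine ⟨convex_univ, fun y _ z _ a b ha hb hab => ?_⟩
  convert hf.2 (Set.mem_univ (Fin.cons x y)) (Set.mem_univ (Fin.cons x z)) ha hb hab using 2
  ext i
  refine Fin.cases ?_ (fun j => ?_) i
  · simp [← add_mul, hab]
  · simp

theorem ConvexOn.fin_cons_left {n : ℕ} {f : (Fin (n + 1) → ℝ) → ℝ}
    (hf : ConvexOn ℝ Set.univ f) (y : Fin n → ℝ) :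
    ConvexOn ℝ Set.univ fun x : ℝ => f (Fin.cons x y) := by
  refine ⟨convex_univ, fun x _ z _ a b ha hb hab => ?_⟩
  convert hf.2 (Set.mem_univ (Fin.cons x y)) (Set.mem_univ (Fin.cons z y)) ha hb hab using 2
  ext i
  refine Fin.cases ?_ (fun j => ?_) i
  · simp
  · simp [← add_mul, hab]

theorem convexOn_binPrice_cons {n : ℕ} {an ap : ℝ} (hn : an < 0) (hp : 0 < ap)
    {f : (Fin (n + 1) → ℝ) → ℝ} (hf : ConvexOn ℝ Set.univ f) :
    ConvexOn ℝ Set.univ fun x => binPrice n an ap fun y => f (Fin.cons x y) := by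
  refine ⟨convex_univ, fun x _ z _ a b ha hb hab => ?_⟩
  simp only [binPrice, smul_eq_mul, Finset.mul_sum, ← Finset.sum_add_distrib]
  refine Finset.sum_le_sum fun ε _ => ?_
  have weight_nonneg : 0 ≤ ∏ i, (if ε i then -an else ap) / (ap - an) :=
    Finset.prod_nonneg fun i _ => div_nonneg (by split_ifs <;> linarith) (by linarith)
  have := (hf.fin_cons_left fun i => if ε i then ap else an).2
    (Set.mem_univ x) (Set.mem_univ z) ha hb hab
  calc _ ≤ _ := mul_le_mul_of_nonneg_left this weight_nonneg
    _ = _ := by simp only [smul_eq_mul]; ring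

/-- Outside the open interval `(a, b)`, a convex function lies above its chord over `[a, b]`. -/
theorem ConvexOn.chord_le {g : ℝ → ℝ} (hg : ConvexOn ℝ Set.univ g) {a b x : ℝ} (hab : a < b)
    (hx : x ≤ a ∨ b ≤ x) : g a + (g b - g a) / (b - a) * (x - a) ≤ g x := by
  have hba : 0 < b - a := sub_pos.2 hab
  rcases hx with hx | hx
  · rcases hx.eq_or_lt with rfl | hx
    · simp
    · have := hg.slope_mono_adjacent (Set.mem_univ x) (Set.mem_univ b) hx hab
      rw [div_le_iff₀ (sub_pos.2 hx)] at this
      linarith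
  · rcases hx.eq_or_lt with rfl | hx
    · rw [div_mul_cancel₀ _ hba.ne']
      linarith
    · have := hg.slope_mono_adjacent (Set.mem_univ a) (Set.mem_univ x) hab hx
      rw [le_div_iff₀ (sub_pos.2 hx)] at this
      have cancel : (g b - g a) / (b - a) * (b - a) = g b - g a := div_mul_cancel₀ _ hba.ne'
      linarith

theorem getD_cons_eq_fin_cons {n : ℕ} (x : ℝ) (ξ : List ℝ) :
    (fun i : Fin (n + 1) => (x :: ξ).getD (i : ℕ) 0) =
      Fin.cons x fun i : Fin n => ξ.getD (i : ℕ) 0 := by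
  ext i
  refine Fin.cases ?_ (fun j => ?_) i <;> simp

/-- Any superhedging capital dominates the binomial price. -/
theorem binPrice_le_of_superhedge {X : Finset ℝ} {an ap : ℝ} (hn : an < 0) (hp : 0 < ap)
    (hnX : an ∈ X) (hpX : ap ∈ X) {n : ℕ} {f : (Fin n → ℝ) → ℝ} {α : ℝ} {P : List ℝ → ℝ}
    (h : ∀ ξ : List ℝ, ξ.length = n → (∀ x ∈ ξ, x ∈ X) →
      f (fun i => ξ.getD (i : ℕ) 0) ≤ α + capitalAux P [] ξ) :
    binPrice n an ap f ≤ α := by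
  induction n generalizing α P with
  | zero =>
    rw [binPrice_zero an ap f fun i => ([] : List ℝ).getD (i : ℕ) 0]
    simpa [capitalAux] using h [] rfl (by simp)
  | succ n ih =>
    have step (x : ℝ) (hx : x ∈ X) :
        binPrice n an ap (fun y => f (Fin.cons x y)) ≤ α + P [] * x := by
      refine ih (P := fun l => P (x :: l)) fun ξ hξ hξX => ?_
      have := h (x :: ξ) (by simp [hξ]) (by simpa [hx] using hξX)
      rw [getD_cons_eq_fin_cons] at this
      simpa [capitalAux, capitalAux_cons_prefix, add_assoc] using this
    have hd : 0 < ap - an := by linarith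
    rw [binPrice_succ]
    calc _ ≤ ap / (ap - an) * (α + P [] * an) + -an / (ap - an) * (α + P [] * ap) :=
          add_le_add (mul_le_mul_of_nonneg_left (step an hnX) (div_nonneg hp.le hd.le))
            (mul_le_mul_of_nonneg_left (step ap hpX) (div_nonneg (by linarith) hd.le))
      _ = α := by field_simp; ring

/-- A convex payoff can be subhedged starting from the innermost binomial price. -/
theorem exists_subhedge_of_convexOn {X : Finset ℝ} {an ap : ℝ} (hn : an < 0) (hp : 0 < ap)
    (hX : ∀ x ∈ X, x ≤ an ∨ ap ≤ x) {n : ℕ} {f : (Fin n → ℝ) → ℝ}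
    (hf : ConvexOn ℝ Set.univ f) :
    ∃ P : List ℝ → ℝ, ∀ ξ : List ℝ, ξ.length = n → (∀ x ∈ ξ, x ∈ X) →
      binPrice n an ap f - capitalAux P [] ξ ≤ f (fun i => ξ.getD (i : ℕ) 0) := by
  induction n with
  | zero =>
    refine ⟨fun _ => 0, fun ξ hξ _ => ?_⟩
    rw [List.length_eq_zero_iff.1 hξ,
      binPrice_zero an ap f fun i => ([] : List ℝ).getD (i : ℕ) 0]
    simp [capitalAux]
  | succ n ih =>
    choose Q hQ using fun x => ih (hf.fin_cons_right x)
    set V : ℝ → ℝ := fun x => binPrice n an ap fun y => f (Fin.cons x y) with hV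
    refine ⟨fun l => match l with
      | [] => -((V ap - V an) / (ap - an))
      | x :: l => Q x l, fun ξ hξ hξX => ?_⟩
    obtain ⟨x, ξ, rfl⟩ := List.exists_cons_of_length_eq_add_one hξ
    rw [List.forall_mem_cons] at hξX
    have tail := hQ x ξ (by simpa using hξ) hξX.2
    have chord := (convexOn_binPrice_cons hn hp hf).chord_le (hn.trans hp) (hX x hξX.1)
    have hd : ap - an ≠ 0 := by linarith
    have initial : binPrice (n + 1) an ap f =
        V an + (V ap - V an) / (ap - an) * (0 - an) := by
      rw [binPrice_succ]
      simp only [hV]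
      field_simp
      ring
    rw [getD_cons_eq_fin_cons, initial]
    simp only [capitalAux, List.nil_append, capitalAux_cons_prefix]
    simp only [hV] at *
    linarith

/-- For a convex payoff `f : ℝ^N → ℝ`, if the smallest nonnegative element `a1pos` of `X`
is strictly positive, the lower hedging price of the restriction of `f` to `X^N` is given
by the binomial model on the two innermost values of `X`. -/
theorem lower_price_convex (X : Finset ℝ)
    (hneg : ∃ a ∈ X, a < 0) (hpos : ∃ a ∈ X, 0 < a)
    (N : ℕ) (f : (Fin N → ℝ) → ℝ) (hf : ConvexOn ℝ Set.univ f)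
    (a1neg a1pos : ℝ)
    (ha1n : IsGreatest {x : ℝ | x ∈ X ∧ x < 0} a1neg)
    (ha1p : IsLeast {x : ℝ | x ∈ X ∧ 0 ≤ x} a1pos)
    (ha1ppos : 0 < a1pos) :
    lowerPrice X N (fun ξ => f (fun i => ξ.getD (i : ℕ) 0)) = binPrice N a1neg a1pos f := by
  have hd : ∀ x ∈ X, x ≤ a1neg ∨ a1pos ≤ x := fun x hx =>
    (lt_or_ge x 0).imp (fun h => ha1n.2 ⟨hx, h⟩) fun h => ha1p.2 ⟨hx, h⟩
  rw [lowerPrice, neg_eq_iff_eq_neg]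
  refine IsLeast.csInf_eq ⟨?_, ?_⟩
  · obtain ⟨P, hP⟩ := exists_subhedge_of_convexOn ha1n.1.2 ha1ppos hd hf
    exact ⟨P, fun ξ hξ hξX => by linarith [hP ξ hξ hξX]⟩
  · rintro α ⟨P, hP⟩
    rw [← binPrice_neg]
    exact binPrice_le_of_superhedge ha1n.1.2 ha1ppos ha1n.1.1 ha1p.1.1 hP
end
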